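/- Two regular subgroups of Hol(G) are conjugate in Hol(G) if and only if they are conjugate by an element of the canonical copy of Aut(G): for regular subgroups 𝒢₁, 𝒢₂ of Hol(G), there exists x ∈ Hol(G) with x⁻¹·𝒢₁·x = 𝒢₂ if and only if there exists β ∈ Aut(G) with (1,β)⁻¹·𝒢₁·(1,β) = 𝒢₂. -/

import Mathlib

/-- The holomorph of a group `G`: the semidirect product `G ⋊ Aut(G)`. -/
abbrev Hol (G : Type*) [Group G] :=
  SemidirectProduct G (MulAut G) (MonoidHom.id (MulAut G))

/-- The natural action of `Hol G` on `G`: `(h, α) • g = h * α g`. -/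
instance holMulAction (G : Type*) [Group G] : MulAction (Hol G) G where
  smul x g := x.left * x.right g
  one_smul g := by
    show (1 : Hol G).left * (1 : Hol G).right g = g
    simp
  mul_smul x y g := by
    show (x * y).left * (x * y).right g = x.left * x.right (y.left * y.right g)
    simp [SemidirectProduct.mul_left, SemidirectProduct.mul_right, mul_assoc]

theorem hol_smul_def {G : Type*} [Group G] (x : Hol G) (g : G) :
    x • g = x.left * x.right g := rfl

/-- A subgroup of `Hol G` is regular if its natural action on `G` is transitive and free. -/
def IsRegularSubgroup {G : Type*} [Group G] (𝒢 : Subgroup (Hol G)) : Prop :=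
  (∀ g g' : G, ∃ x ∈ 𝒢, x • g = g') ∧
  (∀ x ∈ 𝒢, ∀ g : G, x • g = g → x = 1)

/-- The conjugate subgroup `x⁻¹ K x`. -/
def conjSubgroup {H : Type*} [Group H] (x : H) (K : Subgroup H) : Subgroup H :=
  K.map (MulAut.conj x⁻¹).toMonoidHom

theorem conjSubgroup_mul_of_mem {H : Type*} [Group H] {K : Subgroup H} {y : H} (hy : y ∈ K)
    (x : H) : conjSubgroup (y * x) K = conjSubgroup x K := by
  ext z
  have mem_conj (w : H) : z ∈ conjSubgroup w K ↔ w * z * w⁻¹ ∈ K := by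
    constructor
    · rintro ⟨k, hk, rfl⟩
      simpa [mul_assoc] using hk
    · intro h
      exact ⟨_, h, by simp [mul_assoc]⟩
  have hxy : y * x * z * (y * x)⁻¹ = y * (x * z * x⁻¹) * y⁻¹ := by group
  rw [mem_conj, mem_conj, hxy, K.mul_mem_cancel_right (K.inv_mem hy), K.mul_mem_cancel_left hy]

theorem eq_inr_of_smul_one {G : Type*} [Group G] {x : Hol G} (hx : x • (1 : G) = 1) :
    x = SemidirectProduct.inr x.right := by
  rw [hol_smul_def, map_one, mul_one] at hx
  ext <;> simp [hx]

/-- Two regular subgroups of `Hol G` are conjugate iff they are conjugate by an element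
of the canonical copy of `Aut G`. -/
theorem regular_conj_iff_aut_conj (G : Type*) [Group G] (𝒢₁ 𝒢₂ : Subgroup (Hol G))
    (hreg₁ : IsRegularSubgroup 𝒢₁) (hreg₂ : IsRegularSubgroup 𝒢₂) :
    (∃ x : Hol G, conjSubgroup x 𝒢₁ = 𝒢₂) ↔
    (∃ β : MulAut G, conjSubgroup (SemidirectProduct.inr β : Hol G) 𝒢₁ = 𝒢₂) := by
  constructor
  · rintro ⟨x, hx⟩
    obtain ⟨y, hy, hyx⟩ := hreg₁.1 (x • (1 : G)) 1
    rw [← mul_smul] at hyx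
    refine ⟨(y * x).right, ?_⟩
    rw [← eq_inr_of_smul_one hyx, conjSubgroup_mul_of_mem hy, hx]
  · rintro ⟨β, hβ⟩
    exact ⟨_, hβ⟩
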